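/- For every pair of real numbers m ≤ M there exists a finite constant C such that for all a, a' ≥ 0 and all b, b' ∈ [m, M], min(√a, √a') · |𝒢(a,b) − 𝒢(a',b')| ≤ C·(|b' − b| + |a' − a| + |√a' − √a|). -/

import Mathlib

noncomputable def Phi (x : ℝ) : ℝ :=
  (Real.sqrt (2 * Real.pi))⁻¹ * ∫ y in Set.Iic x, Real.exp (-y ^ 2 / 2)

/-- The function `Γ` from the paper (depending on the parameter `l`). -/
noncomputable def Gam (l a b : ℝ) : ℝ :=
  if 0 < a then
    l ^ 2 * Phi (-(l * b) / (2 * Real.sqrt a))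
      + l ^ 2 * Real.exp (l ^ 2 * (a - b) / 2) * Phi (l * (b / (2 * Real.sqrt a) - Real.sqrt a))
  else l ^ 2 * Real.exp (-(l ^ 2 * max b 0) / 2)

/-- The function `𝒢` from the paper (depending on the parameter `l`). -/
noncomputable def Gcal (l a b : ℝ) : ℝ :=
  if 0 < a then
    l ^ 2 * Real.exp (l ^ 2 * (a - b) / 2) * Phi (l * (b / (2 * Real.sqrt a) - Real.sqrt a))
  else if 0 < b then l ^ 2 * Real.exp (-(l ^ 2 * b) / 2) else 0

open MeasureTheory Set

lemma integrable_exp_neg_sq_div_two : Integrable fun y : ℝ => Real.exp (-y ^ 2 / 2) := by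
  have h := integrable_exp_neg_mul_sq (b := 1 / 2) (by norm_num)
  refine h.congr (Filter.Eventually.of_forall fun y => ?_)
  simp only
  congr 1
  ring

lemma inv_sqrt_two_pi_le_one : (Real.sqrt (2 * Real.pi))⁻¹ ≤ 1 := by
  apply inv_le_one_of_one_le₀
  rw [Real.one_le_sqrt]
  linarith [Real.pi_gt_three]

lemma hasDerivAt_Phi (x : ℝ) :
    HasDerivAt Phi ((Real.sqrt (2 * Real.pi))⁻¹ * Real.exp (-x ^ 2 / 2)) x := by
  have hcont : Continuous fun y : ℝ => Real.exp (-y ^ 2 / 2) := by fun_prop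
  have h := intervalIntegral.integral_hasDerivAt_right
    (integrable_exp_neg_sq_div_two.intervalIntegrable (a := 0) (b := x))
    hcont.stronglyMeasurable.stronglyMeasurableAtFilter hcont.continuousAt
  have h' := (h.const_add (∫ y in Iic (0 : ℝ), Real.exp (-y ^ 2 / 2))).const_mul
    (Real.sqrt (2 * Real.pi))⁻¹
  refine h'.congr_of_eventuallyEq (Filter.Eventually.of_forall fun z => ?_)
  simp only
  rw [Phi, ← intervalIntegral.integral_Iic_sub_Iic
    integrable_exp_neg_sq_div_two.integrableOn integrable_exp_neg_sq_div_two.integrableOn]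
  ring

lemma Phi_nonneg (x : ℝ) : 0 ≤ Phi x :=
  mul_nonneg (by positivity) (integral_nonneg fun _ => (Real.exp_pos _).le)

lemma Phi_le_one (x : ℝ) : Phi x ≤ 1 := by
  have hle : ∫ y in Iic x, Real.exp (-y ^ 2 / 2) ≤ ∫ y, Real.exp (-y ^ 2 / 2) :=
    setIntegral_le_integral integrable_exp_neg_sq_div_two
      (Filter.Eventually.of_forall fun _ => (Real.exp_pos _).le)
  have hval : ∫ y : ℝ, Real.exp (-y ^ 2 / 2) = Real.sqrt (2 * Real.pi) := by
    have h := integral_gaussian (1 / 2)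
    rw [show Real.pi / (1 / 2) = 2 * Real.pi by ring] at h
    rw [← h]
    congr 1
    funext y
    congr 1
    ring
  rw [Phi, inv_mul_le_iff₀ (by positivity), mul_one]
  exact hle.trans hval.le

/-- The Mills ratio bound. -/
lemma mul_Phi_neg_le {x : ℝ} (hx : 0 < x) : x * Phi (-x) ≤ Real.exp (-x ^ 2 / 2) := by
  have hle : ∫ y in Iic (-x), Real.exp (-y ^ 2 / 2) ≤
      ∫ y in Iic (-x), Real.exp (x ^ 2 / 2) * Real.exp (x * y) := by
    refine setIntegral_mono integrable_exp_neg_sq_div_two.integrableOn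
      ((integrableOn_exp_mul_Iic hx _).const_mul _) fun y => ?_
    simp only
    rw [← Real.exp_add, Real.exp_le_exp]
    nlinarith [sq_nonneg (x + y)]
  rw [integral_const_mul, integral_exp_mul_Iic hx, mul_div_assoc', ← Real.exp_add,
    show x ^ 2 / 2 + x * -x = -x ^ 2 / 2 by ring, le_div_iff₀ hx] at hle
  have hnn : 0 ≤ (∫ y in Iic (-x), Real.exp (-y ^ 2 / 2)) * x :=
    mul_nonneg (integral_nonneg fun _ => (Real.exp_pos _).le) hx.le
  calc x * Phi (-x) = (Real.sqrt (2 * Real.pi))⁻¹ *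
        ((∫ y in Iic (-x), Real.exp (-y ^ 2 / 2)) * x) := by rw [Phi]; ring
    _ ≤ 1 * ((∫ y in Iic (-x), Real.exp (-y ^ 2 / 2)) * x) :=
        mul_le_mul_of_nonneg_right inv_sqrt_two_pi_le_one hnn
    _ ≤ _ := by rwa [one_mul]

/-- `Gcal` without the factor `l ^ 2`, in terms of `s = √a`. -/
noncomputable def expMulPhi (l s b : ℝ) : ℝ :=
  Real.exp (l ^ 2 * (s ^ 2 - b) / 2) * Phi (l * (b / (2 * s) - s))

lemma expMulPhi_nonneg (l s b : ℝ) : 0 ≤ expMulPhi l s b :=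
  mul_nonneg (Real.exp_pos _).le (Phi_nonneg _)

lemma Gcal_of_pos (l b : ℝ) {a : ℝ} (ha : 0 < a) :
    Gcal l a b = l ^ 2 * expMulPhi l (Real.sqrt a) b := by
  rw [Gcal, if_pos ha, expMulPhi, Real.sq_sqrt ha.le, mul_assoc]

lemma exp_mul_gaussian (l b : ℝ) {s : ℝ} (hs : 0 < s) :
    Real.exp (l ^ 2 * (s ^ 2 - b) / 2) * Real.exp (-(l * (b / (2 * s) - s)) ^ 2 / 2) =
      Real.exp (-(l * (b / (2 * s))) ^ 2 / 2) := by
  rw [← Real.exp_add]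
  congr 1
  field_simp
  ring

lemma exp_neg_sq_div_two_le_one (x : ℝ) : Real.exp (-x ^ 2 / 2) ≤ 1 :=
  Real.exp_le_one_iff.2 (by nlinarith [sq_nonneg x])

lemma abs_mul_exp_neg_sq_div_two_le_one (x : ℝ) : |x| * Real.exp (-x ^ 2 / 2) ≤ 1 := by
  rw [neg_div, Real.exp_neg, ← div_eq_mul_inv, div_le_one (Real.exp_pos _)]
  have := Real.add_one_le_exp (x ^ 2 / 2)
  nlinarith [sq_nonneg (|x| - 1), sq_abs x]

lemma mul_expMulPhi_le {l s b M : ℝ} (hl : 0 < l) (hs : 0 < s) (hb : b ≤ M) :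
    s * expMulPhi l s b ≤ 2 / l + 1 + |M| := by
  have hl2 : 0 < 2 / l := by positivity
  rcases le_total b (s ^ 2) with h | h
  · have hbs : b / (2 * s) ≤ s / 2 := by
      rw [div_le_iff₀ (by positivity)]
      nlinarith
    set u := l * (s - b / (2 * s)) with hu
    have hsu : s ≤ 2 / l * u := by
      rw [hu, ← mul_assoc, div_mul_cancel₀ _ hl.ne']
      linarith
    have hupos : 0 < u := mul_pos hl (by linarith)
    have hmills : u * expMulPhi l s b ≤ 1 := by
      have hneg : l * (b / (2 * s) - s) = -u := by rw [hu]; ring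
      have hgauss := exp_mul_gaussian l b hs
      rw [expMulPhi, mul_left_comm, hneg]
      rw [hneg, neg_sq] at hgauss
      calc _ ≤ Real.exp (l ^ 2 * (s ^ 2 - b) / 2) * Real.exp (-u ^ 2 / 2) :=
            mul_le_mul_of_nonneg_left (mul_Phi_neg_le hupos) (Real.exp_pos _).le
        _ ≤ 1 := hgauss.trans_le (exp_neg_sq_div_two_le_one _)
    calc s * expMulPhi l s b ≤ 2 / l * u * expMulPhi l s b :=
          mul_le_mul_of_nonneg_right hsu (expMulPhi_nonneg _ _ _)
      _ = 2 / l * (u * expMulPhi l s b) := by ring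
      _ ≤ 2 / l * 1 := mul_le_mul_of_nonneg_left hmills hl2.le
      _ ≤ _ := by linarith [abs_nonneg M]
  · have hle : expMulPhi l s b ≤ 1 := by
      refine mul_le_one₀ (Real.exp_le_one_iff.2 ?_) (Phi_nonneg _) (Phi_le_one _)
      nlinarith [sq_nonneg l, mul_nonneg (sq_nonneg l) (sub_nonneg.2 h)]
    have := mul_le_mul_of_nonneg_left hle hs.le
    nlinarith [le_abs_self M, sq_nonneg (s - 1)]

lemma hasDerivAt_expMulPhi_left (l b : ℝ) {s : ℝ} (hs : 0 < s) :
    HasDerivAt (fun s => expMulPhi l s b)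
      (l ^ 2 * s * expMulPhi l s b - (Real.sqrt (2 * Real.pi))⁻¹ * (l * (b / (2 * s ^ 2) + 1)) *
        Real.exp (-(l * (b / (2 * s))) ^ 2 / 2)) s := by
  have hE : HasDerivAt (fun s : ℝ => Real.exp (l ^ 2 * (s ^ 2 - b) / 2))
      (Real.exp (l ^ 2 * (s ^ 2 - b) / 2) * (l ^ 2 * s)) s := by
    refine ((((hasDerivAt_pow 2 s).sub_const b).const_mul (l ^ 2)).div_const 2).exp.congr_deriv ?_
    push_cast
    ring
  have hu : HasDerivAt (fun s : ℝ => l * (b / (2 * s) - s)) (-(l * (b / (2 * s ^ 2) + 1))) s := by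
    refine ((((hasDerivAt_const s b).fun_div ((hasDerivAt_id' s).const_mul 2)
      (by simpa using hs.ne')).sub (hasDerivAt_id' s)).const_mul l).congr_deriv ?_
    field_simp
    ring
  refine (hE.mul ((hasDerivAt_Phi _).comp s hu)).congr_deriv ?_
  rw [← exp_mul_gaussian l b hs, expMulPhi, Function.comp]
  ring

lemma hasDerivAt_expMulPhi_right (l b : ℝ) {s : ℝ} (hs : 0 < s) :
    HasDerivAt (fun b => expMulPhi l s b)
      (-(l ^ 2 / 2) * expMulPhi l s b + (Real.sqrt (2 * Real.pi))⁻¹ * (l / (2 * s)) *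
        Real.exp (-(l * (b / (2 * s))) ^ 2 / 2)) b := by
  have hE : HasDerivAt (fun b : ℝ => Real.exp (l ^ 2 * (s ^ 2 - b) / 2))
      (Real.exp (l ^ 2 * (s ^ 2 - b) / 2) * (-(l ^ 2 / 2))) b := by
    refine ((((hasDerivAt_id' b).const_sub (s ^ 2)).const_mul (l ^ 2)).div_const
      2).exp.congr_deriv ?_
    ring
  have hu : HasDerivAt (fun b : ℝ => l * (b / (2 * s) - s)) (l / (2 * s)) b := by
    refine ((((hasDerivAt_id' b).div_const (2 * s)).sub_const s).const_mul l).congr_deriv ?_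
    ring
  refine (hE.mul ((hasDerivAt_Phi _).comp b hu)).congr_deriv ?_
  rw [← exp_mul_gaussian l b hs, expMulPhi, Function.comp]
  ring

lemma mul_abs_deriv_left_le {l s b M : ℝ} (hl : 0 < l) (hs : 0 < s) (hb : b ≤ M) :
    s * |l ^ 2 * s * expMulPhi l s b - (Real.sqrt (2 * Real.pi))⁻¹ *
      (l * (b / (2 * s ^ 2) + 1)) * Real.exp (-(l * (b / (2 * s))) ^ 2 / 2)| ≤
      (l ^ 2 * (2 / l + 1 + |M|) + 1 + l) * (1 + s) := by
  set c := (Real.sqrt (2 * Real.pi))⁻¹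
  set v := l * (b / (2 * s)) with hv
  have hc : |c| ≤ 1 := by
    rw [abs_of_nonneg (by positivity)]
    exact inv_sqrt_two_pi_le_one
  have hF := mul_expMulPhi_le hl hs hb
  set K := 2 / l + 1 + |M|
  have hK : 0 ≤ K := (mul_nonneg hs.le (expMulPhi_nonneg _ _ _)).trans hF
  have hgauss : |(v + l * s) * Real.exp (-v ^ 2 / 2)| ≤ 1 + l * s := by
    rw [add_mul]
    refine (abs_add_le _ _).trans (add_le_add ?_ ?_)
    · rw [abs_mul, Real.abs_exp]
      exact abs_mul_exp_neg_sq_div_two_le_one v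
    · rw [abs_of_nonneg (by positivity)]
      exact mul_le_of_le_one_right (by positivity) (exp_neg_sq_div_two_le_one v)
  have hmain : s * |l ^ 2 * s * expMulPhi l s b - c * (l * (b / (2 * s ^ 2) + 1)) *
      Real.exp (-v ^ 2 / 2)| =
      |l ^ 2 * s * (s * expMulPhi l s b) - c * ((v + l * s) * Real.exp (-v ^ 2 / 2))| := by
    nth_rewrite 1 [← abs_of_pos hs]
    rw [← abs_mul]
    congr 1
    have hsv : s * (l * (b / (2 * s ^ 2) + 1)) = v + l * s := by
      rw [hv]
      field_simp
    rw [← hsv]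
    ring
  rw [hmain]
  refine (abs_sub _ _).trans ?_
  have hfst : |l ^ 2 * s * (s * expMulPhi l s b)| ≤ l ^ 2 * s * K := by
    rw [abs_of_nonneg (mul_nonneg (by positivity) (mul_nonneg hs.le (expMulPhi_nonneg _ _ _)))]
    exact mul_le_mul_of_nonneg_left hF (by positivity)
  have hsnd : |c * ((v + l * s) * Real.exp (-v ^ 2 / 2))| ≤ 1 + l * s := by
    rw [abs_mul]
    exact (mul_le_of_le_one_left (abs_nonneg _) hc).trans hgauss
  have : 0 ≤ l ^ 2 * K := by positivity
  nlinarith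

lemma mul_abs_deriv_right_le {l s b M : ℝ} (hl : 0 < l) (hs : 0 < s) (hb : b ≤ M) :
    s * |-(l ^ 2 / 2) * expMulPhi l s b + (Real.sqrt (2 * Real.pi))⁻¹ * (l / (2 * s)) *
      Real.exp (-(l * (b / (2 * s))) ^ 2 / 2)| ≤ l ^ 2 * (2 / l + 1 + |M|) + 1 + l := by
  set c := (Real.sqrt (2 * Real.pi))⁻¹
  set v := l * (b / (2 * s))
  have hc : c ≤ 1 := inv_sqrt_two_pi_le_one
  have hc0 : 0 ≤ c := by positivity
  have hF := mul_expMulPhi_le hl hs hb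
  set K := 2 / l + 1 + |M|
  have hF0 := mul_nonneg hs.le (expMulPhi_nonneg l s b)
  have hg : c * Real.exp (-v ^ 2 / 2) ≤ 1 :=
    mul_le_one₀ hc (Real.exp_pos _).le (exp_neg_sq_div_two_le_one v)
  have hg0 : 0 ≤ c * Real.exp (-v ^ 2 / 2) := by positivity
  have hmain : s * |-(l ^ 2 / 2) * expMulPhi l s b + c * (l / (2 * s)) *
      Real.exp (-v ^ 2 / 2)| =
      |-(l ^ 2 / 2) * (s * expMulPhi l s b) + l / 2 * (c * Real.exp (-v ^ 2 / 2))| := by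
    nth_rewrite 1 [← abs_of_pos hs]
    rw [← abs_mul]
    congr 1
    field_simp
  rw [hmain, abs_le]
  have h1 := mul_le_mul_of_nonneg_left hF (sq_nonneg l)
  have h2 := mul_nonneg (sq_nonneg l) hF0
  have h3 := mul_le_mul_of_nonneg_left hg hl.le
  have h4 := mul_nonneg hl.le hg0
  constructor <;> linarith

lemma mul_abs_expMulPhi_sub_right_le {l s b b' M : ℝ} (hl : 0 < l) (hs : 0 < s)
    (hb : b ≤ M) (hb' : b' ≤ M) :
    s * |expMulPhi l s b - expMulPhi l s b'| ≤
      (l ^ 2 * (2 / l + 1 + |M|) + 1 + l) * |b - b'| := by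
  have h := (convex_Iic M).norm_image_sub_le_of_norm_hasDerivWithin_le
    (C := (l ^ 2 * (2 / l + 1 + |M|) + 1 + l) / s)
    (fun x _ => (hasDerivAt_expMulPhi_right l x hs).hasDerivWithinAt)
    (fun x hx => by
      rw [le_div_iff₀' hs]
      exact mul_abs_deriv_right_le hl hs hx) hb' hb
  rwa [div_mul_eq_mul_div, le_div_iff₀' hs] at h

lemma mul_abs_expMulPhi_sub_left_le {l s t b M : ℝ} (hl : 0 < l) (hs : 0 < s) (hst : s ≤ t)
    (hb : b ≤ M) :
    s * |expMulPhi l s b - expMulPhi l t b| ≤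
      (l ^ 2 * (2 / l + 1 + |M|) + 1 + l) * ((t - s) + (t ^ 2 - s ^ 2)) := by
  set L := l ^ 2 * (2 / l + 1 + |M|) + 1 + l
  have hL : 0 ≤ L := by positivity
  have h := (convex_Icc s t).norm_image_sub_le_of_norm_hasDerivWithin_le
    (C := L * (1 + s) / s)
    (fun x hx => (hasDerivAt_expMulPhi_left l b (hs.trans_le hx.1)).hasDerivWithinAt)
    (fun x hx => by
      have hx0 := hs.trans_le hx.1
      have hx1 := mul_abs_deriv_left_le hl hx0 hb
      rw [← le_div_iff₀' hx0] at hx1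
      refine hx1.trans ?_
      rw [div_le_div_iff₀ hx0 hs]
      nlinarith [mul_le_mul_of_nonneg_left hx.1 hL])
    (left_mem_Icc.2 hst) (right_mem_Icc.2 hst)
  rw [div_mul_eq_mul_div, le_div_iff₀' hs, norm_sub_rev, Real.norm_eq_abs, Real.norm_eq_abs,
    abs_of_nonneg (sub_nonneg.2 hst)] at h
  refine h.trans ?_
  rw [mul_assoc]
  refine mul_le_mul_of_nonneg_left ?_ hL
  nlinarith

lemma mul_abs_Gcal_sub_le {l a a' b b' M : ℝ} (hl : 0 < l) (ha : 0 < a) (haa' : a ≤ a')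
    (hb : b ≤ M) (hb' : b' ≤ M) :
    Real.sqrt a * |Gcal l a b - Gcal l a' b'| ≤
      l ^ 2 * (l ^ 2 * (2 / l + 1 + |M|) + 1 + l) *
        (|b' - b| + |a' - a| + |Real.sqrt a' - Real.sqrt a|) := by
  have ha' := ha.trans_le haa'
  have hst := Real.sqrt_le_sqrt haa'
  have hs := Real.sqrt_pos.2 ha
  have h1 := mul_abs_expMulPhi_sub_right_le hl hs hb hb'
  have h2 := mul_abs_expMulPhi_sub_left_le hl hs hst hb'
  rw [Real.sq_sqrt ha.le, Real.sq_sqrt ha'.le] at h2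
  rw [Gcal_of_pos l b ha, Gcal_of_pos l b' ha', ← mul_sub, abs_mul, abs_of_nonneg (sq_nonneg l),
    abs_of_nonneg (sub_nonneg.2 haa'), abs_of_nonneg (sub_nonneg.2 hst), abs_sub_comm b' b,
    mul_left_comm, mul_assoc (l ^ 2)]
  refine mul_le_mul_of_nonneg_left ?_ (sq_nonneg l)
  have h3 := mul_le_mul_of_nonneg_left (abs_sub_le (expMulPhi l (Real.sqrt a) b)
    (expMulPhi l (Real.sqrt a) b') (expMulPhi l (Real.sqrt a') b')) hs.le
  linarith

theorem stmt_5 (l : ℝ) (hl : 0 < l) (m M : ℝ) (hmM : m ≤ M) :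
    ∃ C : ℝ, ∀ a a' : ℝ, 0 ≤ a → 0 ≤ a' → ∀ b ∈ Set.Icc m M, ∀ b' ∈ Set.Icc m M,
      min (Real.sqrt a) (Real.sqrt a') * |Gcal l a b - Gcal l a' b'| ≤
        C * (|b' - b| + |a' - a| + |Real.sqrt a' - Real.sqrt a|) := by
  refine ⟨l ^ 2 * (l ^ 2 * (2 / l + 1 + |M|) + 1 + l), fun a a' ha ha' b hb b' hb' => ?_⟩
  rcases ha.eq_or_lt with rfl | ha
  · rw [Real.sqrt_zero, min_eq_left (Real.sqrt_nonneg _), zero_mul]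
    positivity
  rcases ha'.eq_or_lt with rfl | ha'
  · rw [Real.sqrt_zero, min_eq_right (Real.sqrt_nonneg _), zero_mul]
    positivity
  rcases le_total a a' with h | h
  · rw [min_eq_left (Real.sqrt_le_sqrt h)]
    exact mul_abs_Gcal_sub_le hl ha h hb.2 hb'.2
  · rw [min_eq_right (Real.sqrt_le_sqrt h), abs_sub_comm (Gcal l a b), abs_sub_comm b',
      abs_sub_comm a', abs_sub_comm (Real.sqrt a')]
    exact mul_abs_Gcal_sub_le hl ha' h hb'.2 hb.2
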